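/- Let P be a region with at least two pixels and let s be the minimum size of a strip cover of P. Then P admits a tour with at most 6s − 2 turns. Since every tour of P has at least s turns, this tour has at most 6 times the minimum number of turns of a tour of P. -/

import Mathlib

/-- A pixel is a point of `ℤ × ℤ`. -/
abbrev Pixel : Type := ℤ × ℤ

/-- Two pixels are adjacent if their ℓ¹-distance is 1. -/
def Adjacent (p q : Pixel) : Prop := |p.1 - q.1| + |p.2 - q.2| = 1

/-- A cycle: a cyclic sequence of `k ≥ 2` pixels (encoded as a `k`-periodic
function on `ℤ`) in which consecutive pixels are adjacent. -/
structure GridCycle where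
  k : ℕ
  two_le : 2 ≤ k
  pts : ℤ → Pixel
  periodic : ∀ i : ℤ, pts (i + k) = pts i
  adj : ∀ i : ℤ, Adjacent (pts i) (pts (i + 1))

/-- The set of pixels covered by a cycle. -/
def GridCycle.covers (C : GridCycle) : Set Pixel := Set.range C.pts

/-- Turn cost at position `i`: 0 if the walk goes straight, 2 for a U-turn,
1 for a 90° turn. -/
def GridCycle.turnCost (C : GridCycle) (i : ℤ) : ℕ :=
  if C.pts (i + 1) - C.pts i = C.pts i - C.pts (i - 1) then 0
  else if C.pts (i + 1) - C.pts i = -(C.pts i - C.pts (i - 1)) then 2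
  else 1

/-- The number of turns of a cycle: total turn cost over all positions. -/
def GridCycle.turns (C : GridCycle) : ℕ :=
  ∑ i ∈ Finset.range C.k, C.turnCost (i : ℤ)

/-- A set of pixels is connected under adjacency. -/
def ConnectedIn (P : Set Pixel) : Prop :=
  ∀ p ∈ P, ∀ q ∈ P, Relation.ReflTransGen (fun a b => b ∈ P ∧ Adjacent a b) p q

/-- A region is a finite nonempty set of pixels connected under adjacency. -/
def IsRegion (P : Set Pixel) : Prop := P.Finite ∧ P.Nonempty ∧ ConnectedIn P

/-- A tour of `P`: a cycle whose pixels lie in `P` covering every pixel of `P`. -/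
def IsTour (P : Set Pixel) (C : GridCycle) : Prop := C.covers = P

/-- A cycle cover of `P`: a finite collection of cycles with pixels in `P`
covering every pixel of `P`. -/
def IsCycleCover (P : Set Pixel) (CC : List GridCycle) : Prop :=
  (∀ C ∈ CC, C.covers ⊆ P) ∧ ∀ p ∈ P, ∃ C ∈ CC, p ∈ C.covers

/-- The number of turns of a cycle cover. -/
def coverTurns (CC : List GridCycle) : ℕ := (CC.map GridCycle.turns).sum

/-- A horizontal strip of `P`: a maximal horizontal run of pixels of `P`. -/
def IsHStrip (P S : Set Pixel) : Prop :=
  ∃ x y : ℤ, ∃ ℓ : ℕ, S = {p : Pixel | p.2 = y ∧ x ≤ p.1 ∧ p.1 ≤ x + (ℓ : ℤ)} ∧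
    S ⊆ P ∧ (x - 1, y) ∉ P ∧ (x + (ℓ : ℤ) + 1, y) ∉ P

/-- A vertical strip of `P`: a maximal vertical run of pixels of `P`. -/
def IsVStrip (P S : Set Pixel) : Prop :=
  ∃ x y : ℤ, ∃ ℓ : ℕ, S = {p : Pixel | p.1 = x ∧ y ≤ p.2 ∧ p.2 ≤ y + (ℓ : ℤ)} ∧
    S ⊆ P ∧ (x, y - 1) ∉ P ∧ (x, y + (ℓ : ℤ) + 1) ∉ P

/-- A strip of `P` is a horizontal or vertical strip. -/
def IsStrip (P S : Set Pixel) : Prop := IsHStrip P S ∨ IsVStrip P S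

/-- A strip cover of `P`: a set of strips of `P` whose union is `P`. -/
def IsStripCover (P : Set Pixel) (F : Set (Set Pixel)) : Prop :=
  (∀ S ∈ F, IsStrip P S) ∧ ⋃₀ F = P

/-- The minimum size of a strip cover of `P`. -/
noncomputable def minStripCover (P : Set Pixel) : ℕ :=
  sInf {m | ∃ F, IsStripCover P F ∧ F.ncard = m}

/-- A rook placement in `P`: a subset of `P` no two distinct elements of which
lie in a common strip of `P`. -/
def IsRookPlacement (P R : Set Pixel) : Prop :=
  R ⊆ P ∧ ∀ p ∈ R, ∀ q ∈ R, p ≠ q → ¬∃ S, IsStrip P S ∧ p ∈ S ∧ q ∈ S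

/-- A maximal rook placement: every pixel of `P` lies in a common strip with
some element of `R`. -/
def IsMaximalRookPlacement (P R : Set Pixel) : Prop :=
  IsRookPlacement P R ∧ ∀ p ∈ P, ∃ r ∈ R, ∃ S, IsStrip P S ∧ p ∈ S ∧ r ∈ S

/-- The cost of turning from direction `d` to direction `e`. -/
def dirCost (d e : Pixel) : ℕ := if e = d then 0 else if e = -d then 2 else 1

/-- A unit vector of the grid. -/
def IsUnitStep (d : Pixel) : Prop := |d.1| + |d.2| = 1

theorem isUnitStep_iff {d : Pixel} :
    IsUnitStep d ↔ d = (1, 0) ∨ d = (-1, 0) ∨ d = (0, 1) ∨ d = (0, -1) := by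
  obtain ⟨x, y⟩ := d
  simp only [IsUnitStep, Prod.mk.injEq]
  constructor
  · intro h
    rcases abs_cases x with hx | hx <;> rcases abs_cases y with hy | hy <;> omega
  · rintro (h | h | h | h) <;> simp [h.1, h.2]

theorem isUnitStep_sub_iff {p q : Pixel} : IsUnitStep (q - p) ↔ Adjacent p q := by
  simp only [IsUnitStep, Adjacent, Prod.fst_sub, Prod.snd_sub, abs_sub_comm]

theorem IsUnitStep.neg {d : Pixel} (h : IsUnitStep d) : IsUnitStep (-d) := by
  simpa [IsUnitStep] using h

theorem dirCost_le_two (d e : Pixel) : dirCost d e ≤ 2 := by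
  unfold dirCost; split_ifs <;> omega

theorem dirCost_self (d : Pixel) : dirCost d d = 0 := by simp [dirCost]

theorem dirCost_neg {d : Pixel} (h : IsUnitStep d) :
    dirCost d (-d) = 2 ∧ dirCost (-d) d = 2 := by
  rcases isUnitStep_iff.1 h with rfl | rfl | rfl | rfl <;> decide

theorem dirCost_detour_parallel {d e t : Pixel} (hd : IsUnitStep d) (he : IsUnitStep e)
    (ht : IsUnitStep t) :
    dirCost d t + dirCost t e ≤ 2 + dirCost d e ∨
      dirCost d (-t) + dirCost (-t) e ≤ 2 + dirCost d e := by
  rcases isUnitStep_iff.1 hd with rfl | rfl | rfl | rfl <;>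
  rcases isUnitStep_iff.1 he with rfl | rfl | rfl | rfl <;>
  rcases isUnitStep_iff.1 ht with rfl | rfl | rfl | rfl <;> decide

theorem dirCost_detour_side {d e n : Pixel} (hd : IsUnitStep d) (he : IsUnitStep e)
    (hn : IsUnitStep n) (h1 : d ≠ -n) (h2 : e ≠ n) :
    dirCost d n + dirCost (-n) e ≤ 2 + dirCost d e ∧
      (d ≠ e → dirCost d n + dirCost (-n) e ≤ dirCost d e) := by
  revert h1 h2
  rcases isUnitStep_iff.1 hd with rfl | rfl | rfl | rfl <;>
  rcases isUnitStep_iff.1 he with rfl | rfl | rfl | rfl <;>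
  rcases isUnitStep_iff.1 hn with rfl | rfl | rfl | rfl <;> decide

theorem dirCost_perp {u n : Pixel} (hu : IsUnitStep u) (hn : IsUnitStep n) (h1 : n ≠ u)
    (h2 : n ≠ -u) : dirCost n u ≤ 1 ∧ dirCost n (-u) ≤ 1 ∧ dirCost u (-n) ≤ 1 ∧
      dirCost (-u) (-n) ≤ 1 := by
  revert h1 h2
  rcases isUnitStep_iff.1 hu with rfl | rfl | rfl | rfl <;>
  rcases isUnitStep_iff.1 hn with rfl | rfl | rfl | rfl <;> decide

theorem IsUnitStep.eq_or_eq_neg_of_perp {d u n : Pixel} (hd : IsUnitStep d) (hu : IsUnitStep u)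
    (hn : IsUnitStep n) (h1 : n ≠ u) (h2 : n ≠ -u) (h3 : d ≠ n) (h4 : d ≠ -n) :
    d = u ∨ d = -u := by
  revert h1 h2 h3 h4
  rcases isUnitStep_iff.1 hd with rfl | rfl | rfl | rfl <;>
  rcases isUnitStep_iff.1 hu with rfl | rfl | rfl | rfl <;>
  rcases isUnitStep_iff.1 hn with rfl | rfl | rfl | rfl <;> decide

namespace GridCycle

theorem turnCost_eq (C : GridCycle) (i : ℤ) :
    C.turnCost i = dirCost (C.pts i - C.pts (i - 1)) (C.pts (i + 1) - C.pts i) := rfl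

theorem isUnitStep_out (C : GridCycle) (i : ℤ) : IsUnitStep (C.pts (i + 1) - C.pts i) :=
  isUnitStep_sub_iff.2 (C.adj i)

theorem isUnitStep_in (C : GridCycle) (i : ℤ) : IsUnitStep (C.pts i - C.pts (i - 1)) := by
  simpa using C.isUnitStep_out (i - 1)

theorem pts_add_mul (C : GridCycle) (i m : ℤ) : C.pts (i + m * C.k) = C.pts i := by
  have h : Function.Periodic C.pts (C.k : ℤ) := C.periodic
  simpa using h.int_mul m i

theorem pts_emod (C : GridCycle) (i : ℤ) : C.pts (i % C.k) = C.pts i := by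
  have h := C.pts_add_mul (i % C.k) (i / C.k)
  rw [← h, mul_comm, Int.emod_add_mul_ediv]

theorem turnCost_add_mul (C : GridCycle) (i m : ℤ) :
    C.turnCost (i + m * C.k) = C.turnCost i := by
  rw [turnCost_eq, turnCost_eq, C.pts_add_mul,
    show i + m * C.k - 1 = (i - 1) + m * C.k by ring,
    show i + m * C.k + 1 = (i + 1) + m * C.k by ring, C.pts_add_mul, C.pts_add_mul]

theorem turnCost_emod (C : GridCycle) (i : ℤ) : C.turnCost (i % C.k) = C.turnCost i := by
  have h := C.turnCost_add_mul (i % C.k) (i / C.k)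
  rw [← h, mul_comm, Int.emod_add_mul_ediv]

/-- The same cycle, starting at position `n`. -/
def shift (C : GridCycle) (n : ℤ) : GridCycle where
  k := C.k
  two_le := C.two_le
  pts i := C.pts (n + i)
  periodic i := by rw [← add_assoc, C.periodic]
  adj i := by rw [← add_assoc]; exact C.adj _

theorem shift_turnCost (C : GridCycle) (n i : ℤ) :
    (C.shift n).turnCost i = C.turnCost (n + i) := by
  simp only [turnCost_eq, shift, add_assoc, add_sub_assoc]

theorem shift_covers (C : GridCycle) (n : ℤ) : (C.shift n).covers = C.covers := by
  ext p
  constructor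
  · rintro ⟨i, rfl⟩
    exact ⟨n + i, rfl⟩
  · rintro ⟨i, rfl⟩
    exact ⟨i - n, by simp [shift]⟩

theorem shift_turns_nat (C : GridCycle) (n : ℕ) : (C.shift n).turns = C.turns := by
  induction n with
  | zero => simp [turns, shift]
  | succ n ih =>
    rw [← ih]
    simp only [turns, shift_turnCost]
    have h1 := Finset.sum_range_succ (fun i : ℕ => C.turnCost ((n : ℤ) + i)) C.k
    have h2 := Finset.sum_range_succ' (fun i : ℕ => C.turnCost ((n : ℤ) + i)) C.k
    have h3 := C.turnCost_add_mul n 1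
    rw [one_mul] at h3
    simp only [h3, Nat.cast_zero, add_zero] at h1 h2
    have h4 : ∀ i : ℕ, ((n + 1 : ℕ) : ℤ) + i = n + ((i + 1 : ℕ) : ℤ) := by
      intro i; push_cast; ring
    simp only [h4]
    change ∑ i ∈ Finset.range C.k, _ = ∑ i ∈ Finset.range C.k, _
    omega

theorem shift_turns (C : GridCycle) (n : ℤ) : (C.shift n).turns = C.turns := by
  have hk : (0 : ℤ) < C.k := by have := C.two_le; omega
  have h := C.shift_turns_nat (n % C.k).toNat
  rw [Int.toNat_of_nonneg (Int.emod_nonneg _ hk.ne')] at h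
  rw [← h]
  simp only [turns, shift_turnCost]
  refine Finset.sum_congr rfl fun i _ => ?_
  rw [← C.turnCost_emod, ← C.turnCost_emod (n % C.k + i), Int.emod_add_emod]

/-- The cycle repeating the values of `f` on `[0, k)`. -/
def ofFun (k : ℕ) (f : ℤ → Pixel) (hk : 2 ≤ k) (hf : f k = f 0)
    (hadj : ∀ i : ℤ, 0 ≤ i → i < k → Adjacent (f i) (f (i + 1))) : GridCycle where
  k := k
  two_le := hk
  pts i := f (i % k)
  periodic i := by simp
  adj i := by
    have hk0 : (0 : ℤ) < k := by omega
    have h0 := Int.emod_nonneg i hk0.ne'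
    have h1 := Int.emod_lt_of_pos i hk0
    have h2 := hadj _ h0 h1
    convert h2 using 1
    rw [← Int.emod_add_emod]
    by_cases h : i % k + 1 = k
    · rw [h, Int.emod_self, hf]
    · rw [Int.emod_eq_of_lt (by omega) (by omega)]

theorem ofFun_pts {k : ℕ} {f : ℤ → Pixel} (hk : 2 ≤ k) (hf : f k = f 0)
    (hadj : ∀ i : ℤ, 0 ≤ i → i < k → Adjacent (f i) (f (i + 1))) {i : ℤ} (h0 : 0 ≤ i)
    (h1 : i ≤ k) : (ofFun k f hk hf hadj).pts i = f i := by
  change f (i % k) = f i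
  rcases h1.lt_or_eq with h | rfl
  · rw [Int.emod_eq_of_lt h0 h]
  · rw [Int.emod_self, hf]

theorem ofFun_covers {k : ℕ} {f : ℤ → Pixel} (hk : 2 ≤ k) (hf : f k = f 0)
    (hadj : ∀ i : ℤ, 0 ≤ i → i < k → Adjacent (f i) (f (i + 1))) :
    (ofFun k f hk hf hadj).covers = {p | ∃ i : ℤ, 0 ≤ i ∧ i ≤ k ∧ p = f i} := by
  have hk0 : (0 : ℤ) < k := by omega
  ext p
  constructor
  · rintro ⟨i, rfl⟩
    exact ⟨i % k, Int.emod_nonneg i hk0.ne', (Int.emod_lt_of_pos i hk0).le, rfl⟩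
  · rintro ⟨i, h0, h1, rfl⟩
    exact ⟨i, ofFun_pts hk hf hadj h0 h1⟩

theorem covers_eq (C : GridCycle) :
    C.covers = {p | ∃ i : ℤ, 0 ≤ i ∧ i ≤ C.k ∧ p = C.pts i} := by
  have hk : (0 : ℤ) < C.k := by have := C.two_le; omega
  ext p
  constructor
  · rintro ⟨i, rfl⟩
    exact ⟨i % C.k, Int.emod_nonneg i hk.ne', (Int.emod_lt_of_pos i hk).le, (C.pts_emod i).symm⟩
  · rintro ⟨i, -, -, rfl⟩
    exact ⟨i, rfl⟩

theorem exists_splice_zero (X Y : GridCycle) (h : X.pts 0 = Y.pts 0) :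
    ∃ Z : GridCycle, Z.covers = X.covers ∪ Y.covers ∧
      Z.turns + X.turnCost 0 + Y.turnCost 0 = X.turns + Y.turns +
        dirCost (X.pts 0 - X.pts (-1)) (Y.pts 1 - Y.pts 0) +
        dirCost (Y.pts 0 - Y.pts (-1)) (X.pts 1 - X.pts 0) ∧
      ∀ i : ℤ, 0 ≤ i → i ≤ Y.k → Z.pts (X.k + i) = Y.pts i := by
  have hX := X.two_le
  have hY := Y.two_le
  have hXk : X.pts X.k = X.pts 0 := by simpa using X.periodic 0
  have hYk : Y.pts Y.k = Y.pts 0 := by simpa using Y.periodic 0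
  set f : ℤ → Pixel := fun i => if i ≤ X.k then X.pts i else Y.pts (i - X.k) with hfdef
  have hfX : ∀ i : ℤ, i ≤ X.k → f i = X.pts i := fun i hi => if_pos hi
  have hfY : ∀ i : ℤ, 0 ≤ i → f (X.k + i) = Y.pts i := by
    intro i hi
    rcases hi.eq_or_lt with rfl | hi
    · rw [add_zero, hfX _ le_rfl, hXk, h]
    · simp only [hfdef]
      rw [if_neg (by omega), add_sub_cancel_left]
  have hf : f ((X.k + Y.k : ℕ) : ℤ) = f 0 := by
    push_cast
    rw [hfY _ (by omega), hfX _ (by omega), hYk, h]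
  have hadj : ∀ i : ℤ, 0 ≤ i → i < (X.k + Y.k : ℕ) → Adjacent (f i) (f (i + 1)) := by
    intro i h0 h1
    by_cases hi : i + 1 ≤ X.k
    · rw [hfX _ hi, hfX _ (by omega)]
      exact X.adj i
    · obtain ⟨j, rfl⟩ : ∃ j : ℤ, i = X.k + j := ⟨i - X.k, by ring⟩
      rw [add_assoc, hfY _ (by omega), hfY _ (by omega)]
      exact Y.adj j
  have hk : 2 ≤ X.k + Y.k := by omega
  set Z := ofFun (X.k + Y.k) f hk hf hadj with hZ
  have hZX : ∀ i : ℤ, 0 ≤ i → i ≤ X.k → Z.pts i = X.pts i := by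
    intro i h0 h1
    rw [hZ, ofFun_pts hk hf hadj h0 (by push_cast; omega), hfX i h1]
  have hZY : ∀ i : ℤ, 0 ≤ i → i ≤ Y.k → Z.pts (X.k + i) = Y.pts i := by
    intro i h0 h1
    rw [hZ, ofFun_pts hk hf hadj (by omega) (by push_cast; omega), hfY i h0]
  have hZneg : Z.pts (-1) = Y.pts (-1) := by
    rw [← Z.periodic (-1), ← Y.periodic (-1)]
    rw [← hZY _ (by omega) (by omega)]
    congr 1
    simp only [hZ, ofFun]
    push_cast
    ring
  refine ⟨Z, ?_, ?_, hZY⟩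
  · rw [hZ, ofFun_covers, covers_eq X, covers_eq Y]
    ext p
    constructor
    · rintro ⟨i, h0, h1, rfl⟩
      by_cases hi : i ≤ X.k
      · exact Or.inl ⟨i, h0, hi, hfX i hi⟩
      · refine Or.inr ⟨i - X.k, by omega, by push_cast at h1; omega, ?_⟩
        rw [← hfY _ (by omega)]
        congr 1
        ring
    · rintro (⟨i, h0, h1, rfl⟩ | ⟨i, h0, h1, rfl⟩)
      · exact ⟨i, h0, by push_cast; omega, (hfX i h1).symm⟩
      · exact ⟨X.k + i, by omega, by push_cast; omega, (hfY i h0).symm⟩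
  · obtain ⟨a, ha⟩ : ∃ a, X.k = a + 1 := ⟨X.k - 1, by omega⟩
    obtain ⟨b, hb⟩ : ∃ b, Y.k = b + 1 := ⟨Y.k - 1, by omega⟩
    have hZt : Z.turns = ∑ i ∈ Finset.range X.k, Z.turnCost i +
        ∑ i ∈ Finset.range Y.k, Z.turnCost (X.k + i : ℕ) := Finset.sum_range_add _ _ _
    rw [hZt]
    simp only [turns]
    rw [ha, hb, Finset.sum_range_succ', Finset.sum_range_succ', Finset.sum_range_succ',
      Finset.sum_range_succ', ← ha]
    have e1 : ∑ i ∈ Finset.range a, Z.turnCost ((i + 1 : ℕ) : ℤ) =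
        ∑ i ∈ Finset.range a, X.turnCost ((i + 1 : ℕ) : ℤ) := by
      refine Finset.sum_congr rfl fun i hi => ?_
      have := Finset.mem_range.1 hi
      rw [turnCost_eq, turnCost_eq, hZX _ (by omega) (by omega), hZX _ (by omega) (by omega),
        hZX _ (by omega) (by omega)]
    have e2 : ∑ i ∈ Finset.range b, Z.turnCost ((X.k + (i + 1) : ℕ) : ℤ) =
        ∑ i ∈ Finset.range b, Y.turnCost ((i + 1 : ℕ) : ℤ) := by
      refine Finset.sum_congr rfl fun i hi => ?_
      have := Finset.mem_range.1 hi
      rw [turnCost_eq, turnCost_eq, Nat.cast_add, add_assoc, add_sub_assoc,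
        hZY _ (by omega) (by omega), hZY _ (by omega) (by omega), hZY _ (by omega) (by omega)]
    have e3 : Z.turnCost ((0 : ℕ) : ℤ) =
        dirCost (Y.pts 0 - Y.pts (-1)) (X.pts 1 - X.pts 0) := by
      rw [turnCost_eq, Nat.cast_zero, zero_add, zero_sub, hZneg, hZX 0 le_rfl (by omega),
        hZX 1 (by omega) (by omega), h]
    have e4 : Z.turnCost (X.k : ℤ) =
        dirCost (X.pts 0 - X.pts (-1)) (Y.pts 1 - Y.pts 0) := by
      rw [turnCost_eq, hZY 1 (by omega) (by omega), hZX X.k (by omega) (by omega),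
        hZX (X.k - 1) (by omega) (by omega), hXk, ← h,
        show (X.k : ℤ) - 1 = -1 + X.k by ring, X.periodic]
    rw [e1, e2, e3, e4, Nat.cast_zero]
    omega

/-- Two cycles meeting in a pixel can be spliced there; only the two turns at that pixel change. -/
theorem exists_splice (X Y : GridCycle) (i j : ℤ) (h : X.pts i = Y.pts j) :
    ∃ Z : GridCycle, Z.covers = X.covers ∪ Y.covers ∧
      Z.turns + X.turnCost i + Y.turnCost j = X.turns + Y.turns +
        dirCost (X.pts i - X.pts (i - 1)) (Y.pts (j + 1) - Y.pts j) +
        dirCost (Y.pts j - Y.pts (j - 1)) (X.pts (i + 1) - X.pts i) ∧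
      ∃ c : ℤ, ∀ m : ℤ, 0 ≤ m → m ≤ Y.k → Z.pts (c + m) = Y.pts (j + m) := by
  obtain ⟨Z, h1, h2, h3⟩ := exists_splice_zero (X.shift i) (Y.shift j) (by simpa [shift] using h)
  simp only [shift_covers, shift_turns, shift_turnCost] at h1 h2
  refine ⟨Z, h1, ?_, X.k, fun m => h3 m⟩
  simpa [shift, ← sub_eq_add_neg] using h2

end GridCycle

/-- The straight run of `ℓ + 1` pixels starting at `a` in direction `u`. -/
def run (a u : Pixel) (ℓ : ℕ) : Set Pixel := {p | ∃ i : ℤ, 0 ≤ i ∧ i ≤ ℓ ∧ p = a + i • u}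

/-- A straight run can be traversed back and forth with two U-turns. -/
theorem exists_run_cycle (a u : Pixel) (hu : IsUnitStep u) (ℓ : ℕ) (hℓ : 1 ≤ ℓ) :
    ∃ Y : GridCycle, Y.k = 2 * ℓ ∧ Y.covers = run a u ℓ ∧ Y.turns ≤ 4 ∧
      (∀ i : ℤ, 0 < i → i < ℓ →
        (∃ m, Y.pts m = a + i • u ∧ Y.pts m - Y.pts (m - 1) = u ∧ Y.pts (m + 1) - Y.pts m = u) ∧
        (∃ m, Y.pts m = a + i • u ∧ Y.pts m - Y.pts (m - 1) = -u ∧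
          Y.pts (m + 1) - Y.pts m = -u)) ∧
      (∃ m, Y.pts m = a ∧ Y.pts m - Y.pts (m - 1) = -u ∧ Y.pts (m + 1) - Y.pts m = u) ∧
      (∃ m, Y.pts m = a + (ℓ : ℤ) • u ∧ Y.pts m - Y.pts (m - 1) = u ∧
        Y.pts (m + 1) - Y.pts m = -u) := by
  set f : ℤ → Pixel := fun i => a + ((ℓ : ℤ) - |i - ℓ|) • u with hfdef
  have hf1 : ∀ i : ℤ, i ≤ ℓ → f i = a + i • u := by
    intro i hi
    simp only [hfdef]
    rw [abs_of_nonpos (by omega)]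
    congr 2
    ring
  have hf2 : ∀ i : ℤ, ℓ ≤ i → f i = a + (2 * ℓ - i) • u := by
    intro i hi
    simp only [hfdef]
    rw [abs_of_nonneg (by omega)]
    congr 2
    ring
  have hd1 : ∀ i : ℤ, i < ℓ → f (i + 1) - f i = u := by
    intro i hi
    rw [hf1 _ (by omega), hf1 _ (by omega)]
    module
  have hd2 : ∀ i : ℤ, ℓ ≤ i → f (i + 1) - f i = -u := by
    intro i hi
    rw [hf2 _ (by omega), hf2 _ (by omega)]
    module
  have hf : f ((2 * ℓ : ℕ) : ℤ) = f 0 := by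
    rw [hf1 0 (by omega), hf2 _ (by push_cast; omega)]
    push_cast
    module
  have hadj : ∀ i : ℤ, 0 ≤ i → i < (2 * ℓ : ℕ) → Adjacent (f i) (f (i + 1)) := by
    intro i _ _
    rw [← isUnitStep_sub_iff]
    by_cases hi : i < ℓ
    · rw [hd1 i hi]; exact hu
    · rw [hd2 i (by omega)]; exact hu.neg
  have hk : 2 ≤ 2 * ℓ := by omega
  set Y := GridCycle.ofFun (2 * ℓ) f hk hf hadj with hY
  have hp : ∀ i : ℤ, 0 ≤ i → i ≤ 2 * ℓ → Y.pts i = f i := fun i h0 h1 =>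
    GridCycle.ofFun_pts hk hf hadj h0 (by push_cast; exact h1)
  have hpneg : Y.pts (-1) = f (2 * ℓ - 1) := by
    rw [← Y.periodic (-1), ← hp _ (by omega) (by omega)]
    congr 1
  have hout1 : ∀ i : ℤ, 0 ≤ i → i < ℓ → Y.pts (i + 1) - Y.pts i = u := by
    intro i h0 h1
    rw [hp _ (by omega) (by omega), hp _ (by omega) (by omega), hd1 i h1]
  have hout2 : ∀ i : ℤ, ℓ ≤ i → i < 2 * ℓ → Y.pts (i + 1) - Y.pts i = -u := by
    intro i h0 h1
    rw [hp _ (by omega) (by omega), hp _ (by omega) (by omega), hd2 i h0]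
  have hin1 : ∀ i : ℤ, 0 < i → i ≤ ℓ → Y.pts i - Y.pts (i - 1) = u := by
    intro i h0 h1
    simpa using hout1 (i - 1) (by omega) (by omega)
  have hin2 : ∀ i : ℤ, ℓ < i → i < 2 * ℓ → Y.pts i - Y.pts (i - 1) = -u := by
    intro i h0 h1
    simpa using hout2 (i - 1) (by omega) (by omega)
  refine ⟨Y, rfl, ?_, ?_, ?_, ?_, ?_⟩
  · rw [hY, GridCycle.ofFun_covers]
    ext p
    constructor
    · rintro ⟨i, h0, h1, rfl⟩
      push_cast at h1
      by_cases hi : i ≤ ℓ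
      · exact ⟨i, h0, hi, hf1 i hi⟩
      · exact ⟨2 * ℓ - i, by omega, by omega, hf2 i (by omega)⟩
    · rintro ⟨i, h0, h1, rfl⟩
      exact ⟨i, h0, by push_cast; omega, (hf1 i h1).symm⟩
  · have hle : ∀ i ∈ Finset.range (2 * ℓ), Y.turnCost i ≤
        (if i = 0 then 2 else 0) + (if i = ℓ then 2 else 0) := by
      intro i hi
      have hi := Finset.mem_range.1 hi
      rw [GridCycle.turnCost_eq]
      have h2 := dirCost_le_two (Y.pts i - Y.pts (i - 1)) (Y.pts (i + 1) - Y.pts i)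
      by_cases h0 : i = 0
      · rw [if_pos h0]; omega
      by_cases h1 : i = ℓ
      · rw [if_pos h1]; omega
      by_cases h3 : i < ℓ
      · rw [hin1 i (by omega) (by omega), hout1 i (by omega) (by omega), dirCost_self]
        omega
      · rw [hin2 i (by omega) (by omega), hout2 i (by omega) (by omega), dirCost_self]
        omega
    refine (Finset.sum_le_sum hle).trans ?_
    rw [Finset.sum_add_distrib, Finset.sum_ite_eq', Finset.sum_ite_eq']
    split_ifs <;> omega
  · intro i h0 h1
    refine ⟨⟨i, ?_, hin1 i h0 h1.le, hout1 i h0.le h1⟩,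
      ⟨2 * ℓ - i, ?_, hin2 _ (by omega) (by omega), hout2 _ (by omega) (by omega)⟩⟩
    · rw [hp _ (by omega) (by omega), hf1 _ h1.le]
    · rw [hp _ (by omega) (by omega), hf2 _ (by omega)]
      congr 2
      ring
  · refine ⟨0, ?_, ?_, hout1 0 le_rfl (by omega)⟩
    · rw [hp _ (by omega) (by omega), hf1 _ (by omega), zero_smul, add_zero]
    · rw [zero_sub, hpneg, hp _ (by omega) (by omega), hf1 0 (by omega), hf2 _ (by omega)]
      module
  · refine ⟨ℓ, ?_, hin1 _ (by omega) (by omega), hout2 _ (by omega) (by omega)⟩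
    rw [hp _ (by omega) (by omega), hf1 _ (by omega)]

theorem isUnitStep_of_axis {u : Pixel} (h : u = (1, 0) ∨ u = (0, 1)) : IsUnitStep u := by
  rcases h with rfl | rfl <;> simp [IsUnitStep]

theorem isStrip_iff {P S : Set Pixel} : IsStrip P S ↔
    ∃ a u : Pixel, ∃ ℓ : ℕ, (u = (1, 0) ∨ u = (0, 1)) ∧ S = run a u ℓ ∧ S ⊆ P ∧
      a - u ∉ P ∧ a + ((ℓ : ℤ) + 1) • u ∉ P := by
  have hH : ∀ (x y : ℤ) (ℓ : ℕ),
      {p : Pixel | p.2 = y ∧ x ≤ p.1 ∧ p.1 ≤ x + (ℓ : ℤ)} = run (x, y) (1, 0) ℓ := by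
    intro x y ℓ
    ext ⟨p, q⟩
    simp only [run, Set.mem_ofPred_eq, Prod.smul_mk, Prod.mk_add_mk, Prod.mk.injEq, smul_eq_mul]
    constructor
    · rintro ⟨h1, h2, h3⟩
      exact ⟨p - x, by omega, by omega, by omega, by omega⟩
    · rintro ⟨i, h1, h2, h3, h4⟩
      omega
  have hV : ∀ (x y : ℤ) (ℓ : ℕ),
      {p : Pixel | p.1 = x ∧ y ≤ p.2 ∧ p.2 ≤ y + (ℓ : ℤ)} = run (x, y) (0, 1) ℓ := by
    intro x y ℓ
    ext ⟨p, q⟩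
    simp only [run, Set.mem_ofPred_eq, Prod.smul_mk, Prod.mk_add_mk, Prod.mk.injEq, smul_eq_mul]
    constructor
    · rintro ⟨h1, h2, h3⟩
      exact ⟨q - y, by omega, by omega, by omega, by omega⟩
    · rintro ⟨i, h1, h2, h3, h4⟩
      omega
  constructor
  · rintro (⟨x, y, ℓ, h1, h2, h3, h4⟩ | ⟨x, y, ℓ, h1, h2, h3, h4⟩)
    · exact ⟨(x, y), (1, 0), ℓ, Or.inl rfl, h1.trans (hH x y ℓ), h2, by simpa using h3,
        by simpa [add_assoc] using h4⟩
    · exact ⟨(x, y), (0, 1), ℓ, Or.inr rfl, h1.trans (hV x y ℓ), h2, by simpa using h3,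
        by simpa [add_assoc] using h4⟩
  · rintro ⟨⟨x, y⟩, u, ℓ, rfl | rfl, h1, h2, h3, h4⟩
    · exact Or.inl ⟨x, y, ℓ, h1.trans (hH x y ℓ).symm, h2, by simpa using h3,
        by simpa [add_assoc] using h4⟩
    · exact Or.inr ⟨x, y, ℓ, h1.trans (hV x y ℓ).symm, h2, by simpa using h3,
        by simpa [add_assoc] using h4⟩

theorem run_zero (a u : Pixel) : run a u 0 = {a} := by
  ext p
  constructor
  · rintro ⟨i, h0, h1, rfl⟩
    obtain rfl : i = 0 := by push_cast at h1; omega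
    simp
  · rintro rfl
    exact ⟨0, le_rfl, le_rfl, by simp⟩

/-- A cycle meeting a straight run can be extended along that run with at most six extra turns. -/
theorem exists_attach_of_mem (X : GridCycle) {a u r : Pixel} (hu : IsUnitStep u) {ℓ : ℕ}
    (hr : r ∈ run a u ℓ) (hrX : r ∈ X.covers) :
    ∃ Z : GridCycle, Z.covers = X.covers ∪ run a u ℓ ∧ Z.turns ≤ X.turns + 6 := by
  rcases Nat.eq_zero_or_pos ℓ with rfl | hℓ
  · rw [run_zero] at hr ⊢
    obtain rfl : r = a := hr
    exact ⟨X, (Set.union_eq_left.2 (Set.singleton_subset_iff.2 hrX)).symm, by omega⟩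
  obtain ⟨Y, -, hYc, hYt, hint, hleft, hright⟩ := exists_run_cycle a u hu ℓ hℓ
  obtain ⟨i, hi⟩ := hrX
  have hd := X.isUnitStep_in i
  have he := X.isUnitStep_out i
  obtain ⟨c, hc0, hc1, rfl⟩ := hr
  have key : ∀ m, X.pts i = Y.pts m →
      dirCost (X.pts i - X.pts (i - 1)) (Y.pts (m + 1) - Y.pts m) +
        dirCost (Y.pts m - Y.pts (m - 1)) (X.pts (i + 1) - X.pts i) ≤
        2 + X.turnCost i + Y.turnCost m →
      ∃ Z : GridCycle, Z.covers = X.covers ∪ run a u ℓ ∧ Z.turns ≤ X.turns + 6 := by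
    intro m hm hle
    obtain ⟨Z, h1, h2, -⟩ := GridCycle.exists_splice X Y i m hm
    exact ⟨Z, by rw [h1, hYc], by omega⟩
  have hends : ∀ m, X.pts i = Y.pts m → Y.turnCost m = 2 →
      ∃ Z : GridCycle, Z.covers = X.covers ∪ run a u ℓ ∧ Z.turns ≤ X.turns + 6 := by
    intro m hm h2
    refine key m hm ?_
    have h3 := dirCost_le_two (X.pts i - X.pts (i - 1)) (Y.pts (m + 1) - Y.pts m)
    have h4 := dirCost_le_two (Y.pts m - Y.pts (m - 1)) (X.pts (i + 1) - X.pts i)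
    omega
  rcases hc0.eq_or_lt with rfl | hc0
  · obtain ⟨m, h1, h2, h3⟩ := hleft
    refine hends m (by rw [hi, h1]; simp) ?_
    rw [GridCycle.turnCost_eq, h2, h3]
    exact (dirCost_neg hu).2
  rcases hc1.eq_or_lt with rfl | hc1
  · obtain ⟨m, h1, h2, h3⟩ := hright
    refine hends m (by rw [hi, h1]) ?_
    rw [GridCycle.turnCost_eq, h2, h3]
    exact (dirCost_neg hu).1
  obtain ⟨⟨m, h1, h2, h3⟩, ⟨m', h1', h2', h3'⟩⟩ := hint c hc0 hc1
  rcases dirCost_detour_parallel hd he hu with h | h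
  · refine key m (by rw [hi, h1]) ?_
    rw [GridCycle.turnCost_eq, h2, h3]
    omega
  · refine key m' (by rw [hi, h1']) ?_
    rw [GridCycle.turnCost_eq X, h2', h3']
    omega

/-- A cycle passing next to a disjoint parallel run can be extended along that run with at most six
extra turns, provided that the cycle or the run stops at the chosen pair of pixels. -/
theorem exists_attach_of_adjacent {P : Set Pixel} (X : GridCycle) (hX : X.covers ⊆ P)
    {b u q n : Pixel} (hu : IsUnitStep u) (hn : IsUnitStep n) (h1 : n ≠ u) (h2 : n ≠ -u) {ℓ j : ℕ}
    (hj : j ≤ ℓ) (hq : q = b + (j : ℤ) • u) (hqX : q ∉ X.covers) (hpX : q - n ∈ X.covers)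
    (hend : j = ℓ ∨ q - n + u ∉ P) :
    ∃ Z : GridCycle, Z.covers = X.covers ∪ run b u ℓ ∧ Z.turns ≤ X.turns + 6 := by
  obtain ⟨i, hi⟩ := hpX
  have hd := X.isUnitStep_in i
  have he := X.isUnitStep_out i
  set d := X.pts i - X.pts (i - 1) with hd_def
  set e := X.pts (i + 1) - X.pts i with he_def
  have hdn : d ≠ -n := by
    intro h
    refine hqX ⟨i - 1, ?_⟩
    have : X.pts (i - 1) = X.pts i - d := by rw [hd_def]; abel
    rw [this, h, hi]; abel
  have hen : e ≠ n := by
    intro h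
    refine hqX ⟨i + 1, ?_⟩
    have : X.pts (i + 1) = X.pts i + e := by rw [he_def]; abel
    rw [this, h, hi]; abel
  obtain ⟨hside, hside'⟩ := dirCost_detour_side hd he hn hdn hen
  obtain ⟨B, hBk, hBc, hBt, -, ⟨m, hm1, hm2, hm3⟩, -⟩ := exists_run_cycle (q - n) n hn 1 le_rfl
  obtain ⟨X', hc', ht', c, hpts⟩ := GridCycle.exists_splice X B i m (by rw [hi, hm1])
  have hcov : X'.covers = X.covers ∪ {q} := by
    rw [hc', hBc]
    ext p
    constructor
    · rintro (h | ⟨t, h0, h1, rfl⟩)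
      · exact Or.inl h
      · obtain rfl | rfl : t = 0 ∨ t = 1 := by push_cast at h1; omega
        · left; rw [zero_smul, add_zero]; exact ⟨i, hi⟩
        · right; simp
    · rintro (h | h)
      · exact Or.inl h
      · exact Or.inr ⟨1, by omega, by omega, by rw [h]; simp⟩
  rw [GridCycle.turnCost_eq B, hm2, hm3, (dirCost_neg hn).2, GridCycle.turnCost_eq X,
    ← hd_def, ← he_def] at ht'
  rcases Nat.eq_zero_or_pos ℓ with rfl | hℓ
  · obtain rfl : j = 0 := by omega
    obtain rfl : q = b := by simpa using hq
    exact ⟨X', by rw [hcov, run_zero], by omega⟩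
  have hq1 : X'.pts (c + 1) = q := by
    rw [hpts 1 (by omega) (by omega), ← sub_add_cancel (B.pts (m + 1)) (B.pts m), hm3, hm1]
    abel
  have hq0 : X'.pts c = q - n := by
    have := hpts 0 le_rfl (by omega)
    rwa [add_zero, add_zero, hm1] at this
  have hq2 : X'.pts (c + 2) = q - n := by
    rw [hpts 2 (by omega) (by omega), show m + 2 = m + (B.k : ℤ) by rw [hBk]; rfl, B.periodic, hm1]
  have hin : X'.pts (c + 1) - X'.pts (c + 1 - 1) = n := by
    rw [hq1, add_sub_cancel_right, hq0]; abel
  have hout : X'.pts (c + 1 + 1) - X'.pts (c + 1) = -n := by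
    rw [hq1, add_assoc, one_add_one_eq_two, hq2]; abel
  have hturn : X'.turnCost (c + 1) = 2 := by
    rw [GridCycle.turnCost_eq, hin, hout]; exact (dirCost_neg hn).1
  obtain ⟨Y, -, hYc, hYt, hint, hleft, hright⟩ := exists_run_cycle b u hu ℓ hℓ
  obtain ⟨p1, p2, p3, p4⟩ := dirCost_perp hu hn h1 h2
  have hrun : q ∈ run b u ℓ := ⟨j, by omega, by omega, hq⟩
  have key : ∀ m', Y.pts m' = q →
      (Y.pts m' - Y.pts (m' - 1) = u ∨ Y.pts m' - Y.pts (m' - 1) = -u) →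
      (Y.pts (m' + 1) - Y.pts m' = u ∨ Y.pts (m' + 1) - Y.pts m' = -u) →
      X'.turns ≤ X.turns + 2 + Y.turnCost m' →
      ∃ Z : GridCycle, Z.covers = X.covers ∪ run b u ℓ ∧ Z.turns ≤ X.turns + 6 := by
    intro m' hm' ha hb hle
    obtain ⟨Z, z1, z2, -⟩ := GridCycle.exists_splice X' Y (c + 1) m' (by rw [hq1, hm'])
    refine ⟨Z, ?_, ?_⟩
    · rw [z1, hcov, hYc, Set.union_assoc, Set.union_eq_right.2 (Set.singleton_subset_iff.2 hrun)]
    · rw [hin, hout, hturn] at z2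
      have q1 : dirCost n (Y.pts (m' + 1) - Y.pts m') ≤ 1 := by
        rcases hb with hb | hb <;> rw [hb] <;> assumption
      have q2 : dirCost (Y.pts m' - Y.pts (m' - 1)) (-n) ≤ 1 := by
        rcases ha with ha | ha <;> rw [ha] <;> assumption
      omega
  rcases hj.eq_or_lt with rfl | hj
  · obtain ⟨m', k1, k2, k3⟩ := hright
    refine key m' (k1.trans hq.symm) (Or.inl k2) (Or.inr k3) ?_
    rw [GridCycle.turnCost_eq, k2, k3, (dirCost_neg hu).1]
    omega
  have hpu : q - n + u ∉ P := hend.resolve_left hj.ne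
  have hde : d ≠ e := by
    intro h
    have hu' := hd.eq_or_eq_neg_of_perp hu hn h1 h2 (h ▸ hen) hdn
    have hmem : X.pts i + u ∈ X.covers := by
      rcases hu' with hu' | hu'
      · exact ⟨i + 1, by rw [← hu', h, he_def]; abel⟩
      · exact ⟨i - 1, by rw [← neg_eq_iff_eq_neg.2 hu', hd_def]; abel⟩
    rw [hi] at hmem
    exact hpu (hX hmem)
  have hX't : X'.turns ≤ X.turns + 2 := by
    have := hside' hde
    omega
  rcases Nat.eq_zero_or_pos j with rfl | hj0
  · obtain ⟨m', k1, k2, k3⟩ := hleft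
    exact key m' (by rw [k1, hq]; simp) (Or.inr k2) (Or.inl k3) (by omega)
  · obtain ⟨⟨m', k1, k2, k3⟩, -⟩ := hint j (by omega) (by omega)
    exact key m' (by rw [k1, hq]) (Or.inl k2) (Or.inl k3) (by omega)

/-- A strip contains the continuation within the region of any step between two of its pixels. -/
theorem run_step_mem {P : Set Pixel} {a u x : Pixel} {ℓ : ℕ}
    (h1 : a - u ∉ P) (h2 : a + ((ℓ : ℤ) + 1) • u ∉ P) (hx : x ∈ run a u ℓ) :
    (x + u ∈ P → x + u ∈ run a u ℓ) ∧ (x - u ∈ P → x - u ∈ run a u ℓ) := by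
  obtain ⟨i, h0, hi, rfl⟩ := hx
  constructor
  · intro h
    rcases hi.eq_or_lt with rfl | hi
    · refine absurd ?_ h2
      convert h using 1
      module
    · exact ⟨i + 1, by omega, by omega, by module⟩
  · intro h
    rcases h0.eq_or_lt with rfl | h0
    · refine absurd ?_ h1
      convert h using 1
      module
    · exact ⟨i - 1, by omega, by omega, by module⟩

/-- A cycle covering a union of strips can be extended along any adjacent strip with at most six
extra turns. -/
theorem exists_attach {P : Set Pixel} (X : GridCycle) (hX : X.covers ⊆ P)
    (hU : ∀ p ∈ X.covers, ∃ S, IsStrip P S ∧ p ∈ S ∧ S ⊆ X.covers) {T : Set Pixel}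
    (hT : IsStrip P T) {p q : Pixel} (hp : p ∈ X.covers) (hq : q ∈ T) (hpq : Adjacent p q) :
    ∃ Z : GridCycle, Z.covers = X.covers ∪ T ∧ Z.turns ≤ X.turns + 6 := by
  obtain ⟨b, u, ℓ, hu', rfl, hTP, hT1, hT2⟩ := isStrip_iff.1 hT
  have hu := isUnitStep_of_axis hu'
  by_cases hdisj : ∃ r ∈ run b u ℓ, r ∈ X.covers
  · obtain ⟨r, hr, hrX⟩ := hdisj
    exact exists_attach_of_mem X hu hr hrX
  push Not at hdisj
  obtain ⟨S, hS, hpS, hSX⟩ := hU p hp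
  obtain ⟨a, v, k, hv', rfl, hSP, hS1, hS2⟩ := isStrip_iff.1 hS
  have hv := isUnitStep_of_axis hv'
  have hn : IsUnitStep (q - p) := isUnitStep_sub_iff.2 hpq
  obtain ⟨n, rfl⟩ : ∃ n, q = p + n := ⟨q - p, by abel⟩
  rw [add_sub_cancel_left] at hn
  have stepT := run_step_mem hT1 hT2 hq
  have stepS := run_step_mem hS1 hS2 hpS
  have hnu : n ≠ u := by
    rintro rfl
    rw [add_sub_cancel_right] at stepT
    exact hdisj p (stepT.2 (hX hp)) hp
  have hnu' : n ≠ -u := by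
    rintro rfl
    rw [neg_add_cancel_right] at stepT
    exact hdisj p (stepT.1 (hX hp)) hp
  have hnv : n ≠ v := by
    rintro rfl
    exact hdisj _ hq (hSX (stepS.1 (hTP hq)))
  have hnv' : n ≠ -v := by
    rintro rfl
    rw [← sub_eq_add_neg] at hq
    exact hdisj _ hq (hSX (stepS.2 (hTP hq)))
  obtain rfl : v = u := by
    revert hnu hnu' hnv hnv'
    rcases hu' with rfl | rfl <;> rcases hv' with rfl | rfl <;>
    rcases isUnitStep_iff.1 hn with rfl | rfl | rfl | rfl <;> decide
  obtain ⟨i, hi0, hi1, hpi⟩ := hpS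
  obtain ⟨j, hj0, hj1, hqj⟩ := hq
  set t := min (k - i) (ℓ - j) with ht
  have hq' : b + ((j + t).toNat : ℤ) • v = p + n + t • v := by
    rw [Int.toNat_of_nonneg (by omega), hqj]; module
  have hp' : a + (i + t) • v = p + t • v := by rw [hpi]; module
  refine exists_attach_of_adjacent X hX (q := p + n + t • v) (j := (j + t).toNat) hu hn hnu hnu'
    (by omega) hq'.symm ?_ ?_ ?_
  · rw [← hq']
    exact hdisj _ ⟨_, by omega, by omega, rfl⟩
  · refine hSX ⟨i + t, by omega, by omega, ?_⟩
    rw [hp']; abel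
  · by_cases hmin : k - i ≤ ℓ - j
    · right
      rw [show p + n + t • v - n + v = a + ((k : ℤ) + 1) • v by
        rw [ht, min_eq_left hmin, hpi]; module]
      exact hS2
    · left; omega

theorem exists_ray_end {P : Set Pixel} (hP : P.Finite) {p u : Pixel} (hp : p ∈ P) (hu : u ≠ 0) :
    ∃ m : ℕ, (∀ i : ℤ, 0 ≤ i → i ≤ m → p + i • u ∈ P) ∧ p + ((m : ℤ) + 1) • u ∉ P := by
  classical
  have hex : ∃ m : ℕ, p + ((m : ℤ) + 1) • u ∉ P := by
    by_contra! h
    refine Set.infinite_of_injective_forall_mem (f := fun m : ℕ => p + ((m : ℤ) + 1) • u) ?_ h hP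
    intro m m' hmm
    have h1 := smul_left_injective ℤ hu (add_left_cancel hmm)
    omega
  refine ⟨Nat.find hex, fun i h0 h1 => ?_, Nat.find_spec hex⟩
  rcases h0.eq_or_lt with rfl | h0
  · simpa using hp
  · have h2 := Nat.find_min hex (m := (i - 1).toNat) (by omega)
    rw [not_not, Int.toNat_of_nonneg (by omega), sub_add_cancel] at h2
    exact h2

theorem exists_strip_through {P : Set Pixel} (hP : P.Finite) {p u : Pixel} (hp : p ∈ P)
    (hu : u = (1, 0) ∨ u = (0, 1)) :
    ∃ S, IsStrip P S ∧ p ∈ S ∧ (p + u ∈ P → p + u ∈ S) ∧ (p - u ∈ P → p - u ∈ S) := by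
  have hu0 : u ≠ 0 := by rcases hu with rfl | rfl <;> decide
  obtain ⟨m, hm1, hm2⟩ := exists_ray_end hP hp hu0
  obtain ⟨m', hm1', hm2'⟩ := exists_ray_end hP hp (neg_ne_zero.2 hu0)
  have hl : p - (m' : ℤ) • u - u ∉ P := by
    convert hm2' using 2
    module
  have hr : p - (m' : ℤ) • u + (((m' + m : ℕ) : ℤ) + 1) • u ∉ P := by
    convert hm2 using 2
    push_cast
    module
  have hp' : p ∈ run (p - (m' : ℤ) • u) u (m' + m) := ⟨m', by omega, by omega, by abel⟩
  refine ⟨_, isStrip_iff.2 ⟨_, u, m' + m, hu, rfl, ?_, hl, hr⟩, hp', run_step_mem hl hr hp'⟩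
  rintro x ⟨i, h0, h1, rfl⟩
  by_cases hi : i ≤ m'
  · convert hm1' (m' - i) (by omega) (by omega) using 1
    module
  · convert hm1 (i - m') (by omega) (by push_cast at h1; omega) using 1
    module

theorem exists_strip_of_adjacent {P : Set Pixel} (hP : P.Finite) {p q : Pixel} (hp : p ∈ P)
    (hq : q ∈ P) (hpq : Adjacent p q) : ∃ S, IsStrip P S ∧ p ∈ S ∧ q ∈ S := by
  obtain ⟨n, rfl⟩ : ∃ n, q = p + n := ⟨q - p, by abel⟩
  have hn : IsUnitStep n := by simpa using isUnitStep_sub_iff.2 hpq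
  have key : ∃ u : Pixel, (u = (1, 0) ∨ u = (0, 1)) ∧ (n = u ∨ n = -u) := by
    rcases isUnitStep_iff.1 hn with rfl | rfl | rfl | rfl
    exacts [⟨(1, 0), by decide⟩, ⟨(1, 0), by decide⟩, ⟨(0, 1), by decide⟩, ⟨(0, 1), by decide⟩]
  obtain ⟨u, hu, h⟩ := key
  obtain ⟨S, h1, h2, h3, h4⟩ := exists_strip_through hP hp hu
  rcases h with rfl | rfl
  · exact ⟨S, h1, h2, h3 hq⟩
  · rw [← sub_eq_add_neg] at hq ⊢
    exact ⟨S, h1, h2, h4 hq⟩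

theorem IsStrip.subset {P S : Set Pixel} (h : IsStrip P S) : S ⊆ P := by
  obtain ⟨a, u, ℓ, -, -, h, -⟩ := isStrip_iff.1 h
  exact h

/-- Going straight through two pixels of a strip never leaves the strip. -/
theorem IsStrip.straight_mem {P S : Set Pixel} (h : IsStrip P S) {x y z : Pixel} (hx : x ∈ S)
    (hy : y ∈ S) (hz : z ∈ P) (hxy : Adjacent x y) (hyz : z - y = y - x) : z ∈ S := by
  obtain ⟨a, u, ℓ, hu, rfl, -, h1, h2⟩ := isStrip_iff.1 h
  have hstep := run_step_mem h1 h2 hy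
  obtain ⟨i, -, -, hi⟩ := hx
  obtain ⟨j, -, -, hj⟩ := hy
  have hd : y - x = (j - i) • u := by rw [hi, hj]; module
  have hunit : IsUnitStep ((j - i) • u) := hd ▸ isUnitStep_sub_iff.2 hxy
  have hz' : z = y + (j - i) • u := by rw [← hd, ← hyz]; abel
  have hji : j - i = 1 ∨ j - i = -1 := by
    have habs : |j - i| = 1 := by
      rcases hu with rfl | rfl <;> simpa [IsUnitStep] using hunit
    exact (abs_eq zero_le_one).1 habs
  rcases hji with hji | hji <;> rw [hji] at hz'
  · rw [one_smul] at hz'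
    subst hz'
    exact hstep.1 hz
  · rw [neg_one_smul, ← sub_eq_add_neg] at hz'
    subst hz'
    exact hstep.2 hz

namespace GridCycle

theorem out_eq_in_of_turnCost_eq_zero (C : GridCycle) {i : ℤ} (h : C.turnCost i = 0) :
    C.pts (i + 1) - C.pts i = C.pts i - C.pts (i - 1) := by
  unfold turnCost at h
  split_ifs at h with h1
  exact h1

theorem exists_turnCost_ne_zero (C : GridCycle) : ∃ i, C.turnCost i ≠ 0 := by
  by_contra! h
  have hstep : ∀ n : ℕ, C.pts n = C.pts 0 + (n : ℤ) • (C.pts 1 - C.pts 0) ∧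
      C.pts (n + 1) - C.pts n = C.pts 1 - C.pts 0 := by
    intro n
    induction n with
    | zero => simp
    | succ n ih =>
      have h1 := C.out_eq_in_of_turnCost_eq_zero (h ((n : ℤ) + 1))
      rw [add_sub_cancel_right, ih.2] at h1
      refine ⟨?_, by push_cast; exact h1⟩
      have h2 : C.pts ((n : ℤ) + 1) = C.pts n + (C.pts 1 - C.pts 0) := by rw [← ih.2]; abel
      push_cast
      rw [h2, ih.1]
      module
  have h1 := (hstep C.k).1
  have h2 : C.pts C.k = C.pts 0 := by simpa using C.periodic 0
  rw [h2, left_eq_add, smul_eq_zero] at h1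
  have hk := C.two_le
  rcases h1 with h1 | h1
  · omega
  · have h3 := C.isUnitStep_out 0
    rw [zero_add, h1] at h3
    simp [IsUnitStep] at h3

/-- The strips followed after the turns of a tour form a strip cover. -/
theorem exists_stripCover_ncard_le (C : GridCycle) {P : Set Pixel} (hP : P.Finite)
    (hC : IsTour P C) : ∃ F, IsStripCover P F ∧ F.ncard ≤ C.turns := by
  classical
  have hk : (0 : ℤ) < C.k := by have := C.two_le; omega
  have hmem : ∀ i, C.pts i ∈ P := fun i => hC.subset ⟨i, rfl⟩
  choose S hS h1 h2 using fun i => exists_strip_of_adjacent hP (hmem i) (hmem (i + 1)) (C.adj i)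
  set I : Finset ℕ := (Finset.range C.k).filter fun i => C.turnCost i ≠ 0 with hI
  set F : Finset (Set Pixel) := I.image fun i : ℕ => S i with hF
  have hturn : ∀ j, C.turnCost j ≠ 0 → ∃ T ∈ F, C.pts j ∈ T ∧ C.pts (j + 1) ∈ T := by
    intro j hj
    have hj0 := Int.emod_nonneg j hk.ne'
    have hcast : ((j % C.k).toNat : ℤ) = j % C.k := Int.toNat_of_nonneg hj0
    refine ⟨S (j % C.k), ?_, ?_, ?_⟩
    · refine Finset.mem_image.2 ⟨(j % C.k).toNat, Finset.mem_filter.2 ⟨?_, ?_⟩, by rw [hcast]⟩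
      · have := Int.emod_lt_of_pos j hk
        exact Finset.mem_range.2 (by omega)
      · rwa [hcast, C.turnCost_emod]
    · have := h1 (j % C.k)
      rwa [C.pts_emod] at this
    · have := h2 (j % C.k)
      rwa [← C.pts_emod, Int.emod_add_emod, C.pts_emod] at this
  have hFS : ∀ T ∈ F, IsStrip P T := by
    intro T hT
    obtain ⟨i, -, rfl⟩ := Finset.mem_image.1 hT
    exact hS i
  obtain ⟨i₀, hi₀⟩ := C.exists_turnCost_ne_zero
  have hall : ∀ n : ℕ, ∃ T ∈ F, C.pts (i₀ + n) ∈ T ∧ C.pts (i₀ + n + 1) ∈ T := by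
    intro n
    induction n with
    | zero => simpa using hturn i₀ hi₀
    | succ n ih =>
      by_cases hc : C.turnCost (i₀ + n + 1) = 0
      · obtain ⟨T, hT, ha, hb⟩ := ih
        have h3 := C.out_eq_in_of_turnCost_eq_zero hc
        rw [add_sub_cancel_right] at h3
        refine ⟨T, hT, ?_, ?_⟩
        · push_cast
          rwa [← add_assoc]
        · push_cast
          rw [← add_assoc]
          exact (hFS T hT).straight_mem ha hb (hmem _) (C.adj _) h3
      · have h3 := hturn _ hc
        push_cast
        rwa [← add_assoc]
  refine ⟨F, ⟨hFS, ?_⟩, ?_⟩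
  · refine Set.Subset.antisymm (Set.sUnion_subset fun T hT => (hFS T hT).subset) fun p hp => ?_
    obtain ⟨j, rfl⟩ : p ∈ C.covers := hC.symm ▸ hp
    obtain ⟨T, hT, ha, -⟩ := hall ((j - i₀) % C.k).toNat
    rw [Int.toNat_of_nonneg (Int.emod_nonneg _ hk.ne'), ← C.pts_emod, Int.add_emod_emod,
      C.pts_emod, add_sub_cancel] at ha
    exact ⟨T, hT, ha⟩
  · rw [Set.ncard_coe_finset]
    calc F.card ≤ I.card := Finset.card_image_le
      _ = ∑ i ∈ I, 1 := by simp
      _ ≤ ∑ i ∈ I, C.turnCost i := Finset.sum_le_sum fun i hi => by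
        have := (Finset.mem_filter.1 hi).2
        omega
      _ ≤ C.turns := Finset.sum_le_sum_of_subset (Finset.filter_subset _ _)

end GridCycle

theorem exists_adjacent_boundary {P U : Set Pixel} (hP : ConnectedIn P) {p q : Pixel} (hp : p ∈ P)
    (hpU : p ∈ U) (hq : q ∈ P) (hqU : q ∉ U) : ∃ x ∈ U, ∃ y ∈ P, y ∉ U ∧ Adjacent x y := by
  have h := hP p hp q hq
  induction h with
  | refl => exact absurd hpU hqU
  | @tail b c _ hbc ih =>
    by_cases hb : b ∈ U
    · exact ⟨b, hb, c, hq, hqU, hbc.2⟩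
    · rename_i hab
      refine ih ?_ hb
      rcases Relation.ReflTransGen.cases_tail hab with rfl | ⟨_, _, h⟩
      · exact hp
      · exact h.1

/-- A cycle covering a union of strips extends to a tour, with at most six extra turns for every
strip of a given cover that it does not cover yet. -/
theorem exists_tour_extending {P : Set Pixel} (hP : IsRegion P) {F : Set (Set Pixel)}
    (hF : IsStripCover P F) (hFfin : F.Finite) (n : ℕ) : ∀ X : GridCycle, X.covers ⊆ P →
    (∀ p ∈ X.covers, ∃ S, IsStrip P S ∧ p ∈ S ∧ S ⊆ X.covers) →
    {T ∈ F | ¬ T ⊆ X.covers}.ncard ≤ n → ∃ Z : GridCycle, IsTour P Z ∧ Z.turns ≤ X.turns + 6 * n := by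
  induction n with
  | zero =>
    intro X hX _ hn
    have hempty := (Set.ncard_eq_zero (hFfin.subset (Set.sep_subset _ _))).1 (Nat.le_zero.1 hn)
    refine ⟨X, hX.antisymm ?_, by omega⟩
    rw [← hF.2]
    refine Set.sUnion_subset fun T hT => ?_
    by_contra hTX
    have : T ∈ {T ∈ F | ¬ T ⊆ X.covers} := ⟨hT, hTX⟩
    rw [hempty] at this
    exact this
  | succ n ih =>
    intro X hX hU hn
    by_cases hcov : P ⊆ X.covers
    · exact ⟨X, hX.antisymm hcov, by omega⟩
    obtain ⟨q, hq, hqX⟩ := Set.not_subset.1 hcov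
    have h0 : X.pts 0 ∈ X.covers := ⟨0, rfl⟩
    obtain ⟨x, hx, y, hy, hyX, hxy⟩ := exists_adjacent_boundary hP.2.2 (hX h0) h0 hq hqX
    obtain ⟨T, hT, hyT⟩ : y ∈ ⋃₀ F := hF.2.symm ▸ hy
    have hTs := hF.1 T hT
    obtain ⟨X', hc, ht⟩ := exists_attach X hX hU hTs hx hyT hxy
    suffices h : ∃ Z : GridCycle, IsTour P Z ∧ Z.turns ≤ X'.turns + 6 * n by
      obtain ⟨Z, hZ, hZt⟩ := h
      exact ⟨Z, hZ, by omega⟩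
    refine ih X' ?_ ?_ ?_
    · rw [hc]
      exact Set.union_subset hX hTs.subset
    · rw [hc]
      rintro p (hp | hp)
      · obtain ⟨S, hS, hpS, hSX⟩ := hU p hp
        exact ⟨S, hS, hpS, hSX.trans Set.subset_union_left⟩
      · exact ⟨T, hTs, hp, Set.subset_union_right⟩
    · have hlt : {S ∈ F | ¬ S ⊆ X'.covers}.ncard < {S ∈ F | ¬ S ⊆ X.covers}.ncard := by
        refine Set.ncard_lt_ncard ?_ (hFfin.subset (Set.sep_subset _ _))
        rw [Set.ssubset_iff_of_subset]
        · exact ⟨T, ⟨hT, fun h => hyX (h hyT)⟩, fun h => h.2 (hc.symm ▸ Set.subset_union_right)⟩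
        · exact fun S hS => ⟨hS.1, fun h => hS.2 (h.trans (hc.symm ▸ Set.subset_union_left))⟩
      omega

theorem exists_strip_nontrivial {P : Set Pixel} (hP : IsRegion P) (h2 : 2 ≤ P.ncard)
    {T : Set Pixel} (hT : IsStrip P T) :
    ∃ S, IsStrip P S ∧ T ⊆ S ∧ ∃ C : GridCycle, C.covers = S ∧ C.turns ≤ 4 := by
  obtain ⟨a, u, ℓ, hu, rfl, hTP, -⟩ := isStrip_iff.1 hT
  rcases Nat.eq_zero_or_pos ℓ with rfl | hℓ
  · rw [run_zero] at hTP ⊢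
    have ha : a ∈ P := hTP rfl
    obtain ⟨b, hb, hba⟩ := Set.exists_ne_of_one_lt_ncard h2 a
    obtain ⟨x, rfl, y, hy, hyx, hxy⟩ :=
      exists_adjacent_boundary (U := {a}) hP.2.2 ha rfl hb hba
    obtain ⟨S, hS, hxS, hyS⟩ := exists_strip_of_adjacent hP.1 ha hy hxy
    refine ⟨S, hS, Set.singleton_subset_iff.2 hxS, ?_⟩
    obtain ⟨c, v, k, hv, rfl, -⟩ := isStrip_iff.1 hS
    rcases Nat.eq_zero_or_pos k with rfl | hk
    · rw [run_zero] at hxS hyS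
      exact absurd (hyS.trans hxS.symm) hyx
    · obtain ⟨Y, -, hYc, hYt, -⟩ := exists_run_cycle c v (isUnitStep_of_axis hv) k hk
      exact ⟨Y, hYc, hYt⟩
  · obtain ⟨Y, -, hYc, hYt, -⟩ := exists_run_cycle a u (isUnitStep_of_axis hu) ℓ hℓ
    exact ⟨_, hT, subset_rfl, Y, hYc, hYt⟩

theorem exists_stripCover_ncard_eq {P : Set Pixel} (hP : P.Finite) :
    ∃ F, IsStripCover P F ∧ F.ncard = minStripCover P := by
  refine Nat.sInf_mem (s := {m | ∃ F, IsStripCover P F ∧ F.ncard = m})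
    ⟨_, {S | IsStrip P S}, ⟨fun _ h => h, ?_⟩, rfl⟩
  refine Set.Subset.antisymm (Set.sUnion_subset fun S hS => IsStrip.subset hS) fun p hp => ?_
  obtain ⟨S, hS, hpS, -⟩ := exists_strip_through hP hp (Or.inl rfl)
  exact ⟨S, hS, hpS⟩

theorem minStripCover_le_turns {P : Set Pixel} (hP : P.Finite) {C : GridCycle}
    (hC : IsTour P C) : minStripCover P ≤ C.turns := by
  obtain ⟨F, hF, hle⟩ := C.exists_stripCover_ncard_le hP hC
  have hmem : F.ncard ∈ {m | ∃ F, IsStripCover P F ∧ F.ncard = m} := ⟨F, hF, rfl⟩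
  exact (Nat.sInf_le hmem).trans hle

theorem exists_tour_turns_le {P : Set Pixel} (hP : IsRegion P) (h2 : 2 ≤ P.ncard) :
    ∃ C : GridCycle, IsTour P C ∧ C.turns ≤ 6 * minStripCover P - 2 := by
  obtain ⟨F, hF, hcard⟩ := exists_stripCover_ncard_eq hP.1
  have hFfin : F.Finite := hP.1.finite_subsets.subset fun S hS => (hF.1 S hS).subset
  obtain ⟨p, hp⟩ := hP.2.1
  obtain ⟨T, hT, -⟩ : p ∈ ⋃₀ F := hF.2.symm ▸ hp
  obtain ⟨S, hS, hTS, X, rfl, hXt⟩ := exists_strip_nontrivial hP h2 (hF.1 T hT)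
  have hlt : {S ∈ F | ¬ S ⊆ X.covers}.ncard < F.ncard := by
    refine Set.ncard_lt_ncard ?_ hFfin
    rw [Set.ssubset_iff_of_subset (Set.sep_subset _ _)]
    exact ⟨T, hT, fun h => h.2 hTS⟩
  obtain ⟨Z, hZ, hZt⟩ := exists_tour_extending hP hF hFfin _ X hS.subset
    (fun p hp => ⟨_, hS, hp, subset_rfl⟩) le_rfl
  exact ⟨Z, hZ, by omega⟩

/-- 6-approximation from an optimal strip cover: for a region `P` with at
least two pixels and minimum strip cover size `s`, every tour of `P` has at
least `s` turns, and `P` admits a tour with at most `6s − 2` turns; hence this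
tour has at most 6 times the minimum number of turns of a tour of `P`. -/
theorem six_approx_tour (P : Set Pixel) (hP : IsRegion P) (h2 : 2 ≤ P.ncard) :
    (∀ C' : GridCycle, IsTour P C' → minStripCover P ≤ C'.turns) ∧
    ∃ C : GridCycle, IsTour P C ∧ C.turns ≤ 6 * minStripCover P - 2 ∧
      ∀ C' : GridCycle, IsTour P C' → C.turns ≤ 6 * C'.turns := by
  obtain ⟨C, hC, hCt⟩ := exists_tour_turns_le hP h2
  refine ⟨fun C' hC' => minStripCover_le_turns hP.1 hC', C, hC, hCt, fun C' hC' => ?_⟩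
  have := minStripCover_le_turns hP.1 hC'
  omega
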